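/- arXiv:2502.04238 — 4 statements merged into one kernel-verified Lean document; each statement's English description precedes it below -/
import Mathlib

section
/- Let Z be a complete metric space and let (D_p)_{p∈𝕌} be a family of nonempty compact subsets of Z satisfying the gluing adjacency condition. Assume: (a) for every h ∈ ℕ and every ε > 0, the set {p ∈ 𝕌 : |p| = h and diam(D_p) > ε} is finite; and (b) for every ε > 0 there exists h ∈ ℕ such that for every p ∈ 𝕌 with |p| > h and every y ∈ D_p there exist q ∈ 𝕌 with |q| ≤ h and z ∈ D_q with d(y,z) ≤ ε. Then the closure of ⋃_{p∈𝕌} D_p in Z is compact. -/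
/-- The Ulam tree: finite sequences of positive integers. The parent of a
nonempty sequence is obtained by deleting its last entry (`List.dropLast`). -/
abbrev UlamTree : Type := List ℕ+

/-- A set that lies within every `ε > 0` of some totally bounded set is totally bounded. -/
theorem totallyBounded_of_forall_exists_dist_le {Z : Type*} [PseudoMetricSpace Z] {s : Set Z}
    (h : ∀ ε : ℝ, 0 < ε → ∃ t : Set Z, TotallyBounded t ∧ ∀ y ∈ s, ∃ z ∈ t, dist y z ≤ ε) :
    TotallyBounded s := by
  refine Metric.totallyBounded_iff.2 fun ε hε ↦ ?_
  obtain ⟨t, ht, hst⟩ := h (ε / 2) (half_pos hε)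
  obtain ⟨c, hc, htc⟩ := Metric.totallyBounded_iff.1 ht (ε / 2) (half_pos hε)
  refine ⟨c, hc, fun y hy ↦ ?_⟩
  obtain ⟨z, hz, hyz⟩ := hst y hy
  obtain ⟨x, hx, hzx⟩ := Set.mem_iUnion₂.1 (htc hz)
  refine Set.mem_iUnion₂.2 ⟨x, hx, ?_⟩
  rw [Metric.mem_ball] at hzx ⊢
  linarith [dist_triangle y z x]

/-- In a glued decoration, the union of the blocks of height at most `h` is totally bounded. -/
theorem totallyBounded_iUnion_length_le {Z : Type*} [PseudoMetricSpace Z] {D : UlamTree → Set Z}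
    (hcpt : ∀ p, IsCompact (D p))
    (hglue : ∀ p : UlamTree, p ≠ [] → (D p ∩ D p.dropLast).Nonempty)
    (hdiam : ∀ (h : ℕ) (ε : ℝ), 0 < ε →
      {p : UlamTree | p.length = h ∧ ε < Metric.diam (D p)}.Finite) (h : ℕ) :
    TotallyBounded (⋃ p ∈ {p : UlamTree | p.length ≤ h}, D p) := by
  induction h with
  | zero =>
    refine (hcpt []).totallyBounded.subset (Set.iUnion₂_subset fun p hp ↦ ?_)
    rw [List.length_eq_zero_iff.1 (Nat.le_zero.1 hp)]
  | succ h ih =>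
    refine totallyBounded_of_forall_exists_dist_le fun ε hε ↦
      ⟨_, ih.union ((hdiam (h + 1) ε hε).isCompact_biUnion fun p _ ↦ hcpt p).totallyBounded,
        fun y hy ↦ ?_⟩
    obtain ⟨p, hp, hyp⟩ := Set.mem_iUnion₂.1 hy
    rw [Set.mem_ofPred_eq] at hp
    by_cases hph : p.length ≤ h
    · exact ⟨y, .inl (Set.mem_iUnion₂.2 ⟨p, hph, hyp⟩), by simpa using hε.le⟩
    have hlen : p.length = h + 1 := by omega
    by_cases hpε : ε < Metric.diam (D p)
    · exact ⟨y, .inr (Set.mem_iUnion₂.2 ⟨p, ⟨hlen, hpε⟩, hyp⟩), by simpa using hε.le⟩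
    obtain ⟨z, hzp, hz⟩ := hglue p (List.ne_nil_of_length_eq_add_one hlen)
    refine ⟨z, .inl (Set.mem_iUnion₂.2 ⟨p.dropLast, ?_, hz⟩), ?_⟩
    · simp [hlen]
    · exact (Metric.dist_le_diam_of_mem (hcpt p).isBounded hyp hzp).trans (not_lt.1 hpε)

/-- Compactness of glued decorations.  If `(D p)` is a family of nonempty
compact subsets of a complete metric space `Z` satisfying the gluing adjacency
condition (`D p` meets `D (PAR p)` for every `p ≠ ∅`), such that (a) at every
height `h` only finitely many blocks have diameter exceeding any given `ε > 0`,
and (b) for every `ε > 0` there is a height `h` such that every point of every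
block at height `> h` is within `ε` of some block at height `≤ h`, then the
closure of the union of all blocks is compact. -/
theorem isCompact_closure_iUnion_of_glued_decoration
    {Z : Type*} [MetricSpace Z] [CompleteSpace Z]
    (D : UlamTree → Set Z)
    (hne : ∀ p, (D p).Nonempty)
    (hcpt : ∀ p, IsCompact (D p))
    (hglue : ∀ p : UlamTree, p ≠ [] → (D p ∩ D p.dropLast).Nonempty)
    (hdiam : ∀ (h : ℕ) (ε : ℝ), 0 < ε →
      {p : UlamTree | p.length = h ∧ ε < Metric.diam (D p)}.Finite)
    (happrox : ∀ ε : ℝ, 0 < ε → ∃ h : ℕ, ∀ p : UlamTree, h < p.length →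
      ∀ y ∈ D p, ∃ q : UlamTree, q.length ≤ h ∧ ∃ z ∈ D q, dist y z ≤ ε) :
    IsCompact (closure (⋃ p : UlamTree, D p)) := by
  refine (TotallyBounded.closure ?_).isCompact_of_isClosed isClosed_closure
  refine totallyBounded_of_forall_exists_dist_le fun ε hε ↦ ?_
  obtain ⟨h, hh⟩ := happrox ε hε
  refine ⟨_, totallyBounded_iUnion_length_le hcpt hglue hdiam h, fun y hy ↦ ?_⟩
  obtain ⟨p, hyp⟩ := Set.mem_iUnion.1 hy
  by_cases hph : p.length ≤ h
  · exact ⟨y, Set.mem_iUnion₂.2 ⟨p, hph, hyp⟩, by simpa using hε.le⟩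
  · obtain ⟨q, hq, z, hz, hyz⟩ := hh p (not_le.1 hph) y hyp
    exact ⟨z, Set.mem_iUnion₂.2 ⟨q, hq, hz⟩, hyz⟩
end

section
/- Let Z be a complete metric space. For each n ∈ ℕ and each p ∈ 𝕌 let D^n_p and D_p be nonempty compact subsets of Z, both families satisfying the gluing adjacency condition. Assume: (1) for every p ∈ 𝕌, the Hausdorff distance between D^n_p and D_p tends to 0 as n → ∞; (2) for every h ∈ ℕ and ε > 0 there exist a finite set I ⊆ {p : |p| = h} and N such that for all n ≥ N, diam(D^n_p) ≤ ε for every p ∉ I with |p| = h; (3) for every ε > 0 there exist h and N such that for all n ≥ N, every p ∈ 𝕌 and every y ∈ D^n_p, there are q with |q| ≤ h and z ∈ D^n_q with d(y,z) ≤ ε. Then the Hausdorff distance (valued in [0,∞]) between the closure of ⋃_{p∈𝕌} D^n_p and the closure of ⋃_{p∈𝕌} D_p tends to 0 as n → ∞. -/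
open Filter

/-- If the blocks are bounded and meet their parents, and at every height all blocks outside a
finite set eventually have small diameter, then up to any error the blocks of bounded height are
eventually covered by finitely many of them. -/
theorem exists_finite_dist_le_of_length_le {Z : Type*} [PseudoMetricSpace Z]
    {D : ℕ → UlamTree → Set Z} (hbdd : ∀ n p, Bornology.IsBounded (D n p))
    (hglue : ∀ (n : ℕ) (p : UlamTree), p ≠ [] → (D n p ∩ D n p.dropLast).Nonempty)
    (hdiam : ∀ (h : ℕ) (ε : ℝ), 0 < ε → ∃ I : Set UlamTree, I.Finite ∧
      ∃ N : ℕ, ∀ n ≥ N, ∀ p : UlamTree, p.length = h → p ∉ I → Metric.diam (D n p) ≤ ε)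
    (h : ℕ) {ε : ℝ} (hε : 0 < ε) :
    ∃ F : Set UlamTree, F.Finite ∧ ∃ N : ℕ, ∀ n ≥ N, ∀ p : UlamTree, p.length ≤ h →
      ∀ y ∈ D n p, ∃ q ∈ F, ∃ z ∈ D n q, dist y z ≤ ε := by
  induction h generalizing ε with
  | zero =>
    refine ⟨{[]}, Set.finite_singleton _, 0, fun n _ p hp y hy => ⟨p, ?_, y, hy, ?_⟩⟩
    · simpa using hp
    · simpa using hε.le
  | succ h ih =>
    obtain ⟨F, hF, N, hN⟩ := ih (half_pos hε)
    obtain ⟨I, hI, M, hM⟩ := hdiam (h + 1) (ε / 2) (half_pos hε)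
    refine ⟨F ∪ I, hF.union hI, max N M, fun n hn p hp y hy => ?_⟩
    have hnN := (le_max_left N M).trans hn
    have hnM := (le_max_right N M).trans hn
    by_cases hpI : p ∈ I
    · exact ⟨p, Or.inr hpI, y, hy, by simpa using hε.le⟩
    rcases Nat.le_succ_iff.mp hp with hlt | heq
    · obtain ⟨q, hq, z, hz, hd⟩ := hN n hnN p hlt y hy
      exact ⟨q, Or.inl hq, z, hz, by linarith⟩
    · have hp0 : p ≠ [] := by
        rintro rfl
        simp at heq
      obtain ⟨x, hx, hx'⟩ := hglue n p hp0
      obtain ⟨q, hq, z, hz, hd⟩ := hN n hnN p.dropLast (by simp [heq]) x hx'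
      have hyx := (Metric.dist_le_diam_of_mem (hbdd n p) hy hx).trans (hM n hnM p heq hpI)
      exact ⟨q, Or.inl hq, z, hz, by linarith [dist_triangle y x z]⟩

/-- Hausdorff-distance convergence of glued decorations.  Let `(Dⁿ_p)` and
`(D_p)` be families of nonempty compact subsets of a complete metric space,
each satisfying the gluing adjacency condition.  If (1) `Dⁿ_p → D_p` in
Hausdorff distance for every `p`, (2) at each height all blocks outside a
finite set eventually have diameter at most `ε`, and (3) for every `ε > 0`
there is a height `h` such that eventually every point of every block is
within `ε` of a block of height `≤ h`, then the closures of the unions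
converge in the (extended) Hausdorff distance. -/
theorem hausdorffEdist_glued_decorations_tendsto
    {Z : Type*} [MetricSpace Z] [CompleteSpace Z]
    (D : ℕ → UlamTree → Set Z) (Dlim : UlamTree → Set Z)
    (hne : ∀ n p, (D n p).Nonempty) (hcpt : ∀ n p, IsCompact (D n p))
    (hne' : ∀ p, (Dlim p).Nonempty) (hcpt' : ∀ p, IsCompact (Dlim p))
    (hglue : ∀ (n : ℕ) (p : UlamTree), p ≠ [] → (D n p ∩ D n p.dropLast).Nonempty)
    (hglue' : ∀ p : UlamTree, p ≠ [] → (Dlim p ∩ Dlim p.dropLast).Nonempty)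
    (h1 : ∀ p : UlamTree,
      Tendsto (fun n => EMetric.hausdorffEdist (D n p) (Dlim p)) atTop (nhds 0))
    (h2 : ∀ (h : ℕ) (ε : ℝ), 0 < ε → ∃ I : Set UlamTree, I.Finite ∧
      I ⊆ {p : UlamTree | p.length = h} ∧ ∃ N : ℕ, ∀ n ≥ N, ∀ p : UlamTree,
        p.length = h → p ∉ I → Metric.diam (D n p) ≤ ε)
    (h3 : ∀ ε : ℝ, 0 < ε → ∃ h N : ℕ, ∀ n ≥ N, ∀ p : UlamTree, ∀ y ∈ D n p,
      ∃ q : UlamTree, q.length ≤ h ∧ ∃ z ∈ D n q, dist y z ≤ ε) :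
    Tendsto
      (fun n => EMetric.hausdorffEdist
        (closure (⋃ p : UlamTree, D n p)) (closure (⋃ p : UlamTree, Dlim p)))
      atTop (nhds 0) := by
  have hcover : ∀ ε : ℝ, 0 < ε → ∃ F : Set UlamTree, F.Finite ∧ ∃ N : ℕ, ∀ n ≥ N,
      ∀ p : UlamTree, ∀ y ∈ D n p, ∃ q ∈ F, ∃ z ∈ D n q, dist y z ≤ ε := by
    intro ε hε
    obtain ⟨h, N, hN⟩ := h3 (ε / 2) (half_pos hε)
    obtain ⟨F, hF, M, hM⟩ := exists_finite_dist_le_of_length_le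
      (fun n p => (hcpt n p).isBounded) hglue
      (fun h ε hε => (h2 h ε hε).imp fun I hI => ⟨hI.1, hI.2.2⟩) h (half_pos hε)
    refine ⟨F, hF, max N M, fun n hn p y hy => ?_⟩
    obtain ⟨q, hq, x, hx, hyx⟩ := hN n ((le_max_left N M).trans hn) p y hy
    obtain ⟨r, hr, z, hz, hxz⟩ := hM n ((le_max_right N M).trans hn) q hq x hx
    exact ⟨r, hr, z, hz, by linarith [dist_triangle y x z]⟩
  have hclose : ∀ ε : ℝ, 0 < ε → ∀ p, ∀ᶠ n in atTop,
      (∀ y ∈ D n p, ∃ z ∈ Dlim p, dist y z ≤ ε) ∧ ∀ y ∈ Dlim p, ∃ z ∈ D n p, dist y z ≤ ε := by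
    intro ε hε p
    filter_upwards [(h1 p).eventually_lt_const (ENNReal.ofReal_pos.mpr hε)] with n hn
    constructor <;> intro y hy
    · obtain ⟨z, hz, hyz⟩ := Metric.exists_edist_lt_of_hausdorffEDist_lt hy hn
      exact ⟨z, hz, (edist_lt_ofReal.mp hyz).le⟩
    · obtain ⟨z, hz, hyz⟩ := Metric.exists_edist_lt_of_hausdorffEDist_lt hy
        (Metric.hausdorffEDist_comm.trans_lt hn)
      exact ⟨z, hz, (edist_lt_ofReal.mp hyz).le⟩
  change Tendsto (fun n => Metric.hausdorffEDist (closure (⋃ p : UlamTree, D n p))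
    (closure (⋃ p : UlamTree, Dlim p))) atTop (nhds 0)
  simp only [Metric.hausdorffEDist_closure]
  have key : ∀ ε : ℝ, 0 < ε → ∀ᶠ n in atTop,
      Metric.hausdorffEDist (⋃ p : UlamTree, D n p) (⋃ p : UlamTree, Dlim p)
        ≤ ENNReal.ofReal ε := by
    intro ε hε
    have hδ : 0 < ε / 4 := by positivity
    obtain ⟨F, hF, N, hN⟩ := hcover (ε / 4) hδ
    filter_upwards [eventually_ge_atTop N,
      (eventually_all_finite hF).mpr fun q _ => hclose (ε / 4) hδ q] with n hn hFn
    refine Metric.hausdorffEDist_le_of_mem_edist ?_ ?_ <;> intro y hy <;>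
      obtain ⟨p, hp⟩ := Set.mem_iUnion.mp hy
    · obtain ⟨q, hq, x, hx, hyx⟩ := hN n hn p y hp
      obtain ⟨z, hz, hxz⟩ := (hFn q hq).1 x hx
      refine ⟨z, Set.mem_iUnion.mpr ⟨q, hz⟩, ?_⟩
      rw [edist_le_ofReal hε.le]
      linarith [dist_triangle y x z]
    · obtain ⟨m, hm, hpm, hFm⟩ := ((eventually_ge_atTop N).and ((hclose (ε / 4) hδ p).and
        ((eventually_all_finite hF).mpr fun q _ => hclose (ε / 4) hδ q))).exists
      obtain ⟨x, hx, hyx⟩ := hpm.2 y hp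
      obtain ⟨q, hq, w, hw, hxw⟩ := hN m hm p x hx
      obtain ⟨v, hv, hwv⟩ := (hFm q hq).1 w hw
      obtain ⟨z, hz, hvz⟩ := (hFn q hq).2 v hv
      refine ⟨z, Set.mem_iUnion.mpr ⟨q, hz⟩, ?_⟩
      rw [edist_le_ofReal hε.le]
      linarith [dist_triangle y x z, dist_triangle x w z, dist_triangle w v z]
  refine ENNReal.tendsto_nhds_zero.mpr fun ε hε => ?_
  obtain ⟨δ, hδ, hδε⟩ := ENNReal.lt_iff_exists_nnreal_btwn.mp hε
  filter_upwards [key δ (by exact_mod_cast hδ)] with n hn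
  exact hn.trans (by simpa using hδε.le)
end

section
/- Let Z be a metric space. For each n ∈ ℕ and p ∈ 𝕌 let μ^n_p and μ_p be finite Borel measures on Z. Assume: (1) for every p, μ^n_p → μ_p weakly as n → ∞ (convergence of integrals of every bounded continuous function); (2) for every h ∈ ℕ and ε > 0 there exist a finite set I ⊆ {p : |p| = h} and N such that for all n ≥ N, ∑_{|p|=h, p∉I} μ^n_p(Z) ≤ ε; (3) for every ε > 0 there exist h and N such that for all n ≥ N, ∑_{|p|>h} μ^n_p(Z) ≤ ε. Then the total mass ∑_{p∈𝕌} μ_p(Z) is finite, and the summed measures converge weakly: for every bounded continuous function f : Z → ℝ, ∫ f d(∑_{p∈𝕌} μ^n_p) → ∫ f d(∑_{p∈𝕌} μ_p) as n → ∞. -/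
open Filter MeasureTheory

/-- A bounded function integrated against a sum of measures is close to the sum of its integrals
over a finite set of indices, with an error controlled by the mass of the other indices. -/
lemma abs_integral_sum_sub_finsetSum_le {Z ι : Type*} [MeasurableSpace Z]
    (ν : ι → Measure Z) [∀ i, IsFiniteMeasure (ν i)] (J : Finset ι) {ε : ℝ} (hε : 0 ≤ ε)
    (hJ : ∑' i : {i // i ∉ J}, ν i Set.univ ≤ ENNReal.ofReal ε)
    {f : Z → ℝ} (hf : StronglyMeasurable f) {C : ℝ} (hC : ∀ z, |f z| ≤ C) (hC0 : 0 ≤ C) :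
    |∫ z, f z ∂(Measure.sum ν) - ∑ i ∈ J, ∫ z, f z ∂(ν i)| ≤ C * ε := by
  have hint (ρ : Measure Z) [IsFiniteMeasure ρ] : Integrable f ρ :=
    Integrable.of_bound hf.aestronglyMeasurable C (ae_of_all _ hC)
  set τ : Measure Z := Measure.sum fun i : {i // i ∉ J} => ν i with hτ
  have hτu : τ Set.univ ≤ ENNReal.ofReal ε := by
    rwa [hτ, Measure.sum_apply _ MeasurableSet.univ]
  have : IsFiniteMeasure τ := ⟨hτu.trans_lt ENNReal.ofReal_lt_top⟩
  have hsplit : Measure.sum ν = (∑ i ∈ J, ν i) + τ := by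
    have h := Measure.sum_add_sum_compl (J : Set ι) ν
    rw [← h, ← Measure.sum_coe_finset]
    rfl
  rw [hsplit, integral_add_measure (hint _) (hint _),
    integral_finsetSum_measure fun i _ => hint _, add_sub_cancel_left]
  refine (norm_integral_le_of_norm_le_const (f := f) (ae_of_all τ hC)).trans ?_
  exact mul_le_mul_of_nonneg_left (ENNReal.toReal_le_of_le_ofReal hε hτu) hC0

/-- Weak convergence passes to sums of measures with uniformly small tails. -/
lemma tsum_ne_top_and_tendsto_integral_sum {Z ι : Type*} [TopologicalSpace Z] [MeasurableSpace Z]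
    [OpensMeasurableSpace Z] (μ : ℕ → ι → Measure Z) (ν : ι → Measure Z)
    [∀ n i, IsFiniteMeasure (μ n i)] [∀ i, IsFiniteMeasure (ν i)]
    (hconv : ∀ i, ∀ f : Z → ℝ, Continuous f → (∃ C : ℝ, ∀ z, |f z| ≤ C) →
      Tendsto (fun n => ∫ z, f z ∂(μ n i)) atTop (nhds (∫ z, f z ∂(ν i))))
    (htail : ∀ ε : ℝ, 0 < ε → ∃ J : Finset ι, ∀ᶠ n in atTop,
      ∑' i : {i // i ∉ J}, μ n i Set.univ ≤ ENNReal.ofReal ε) :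
    (∑' i, ν i Set.univ ≠ ⊤) ∧ ∀ f : Z → ℝ, Continuous f → (∃ C : ℝ, ∀ z, |f z| ≤ C) →
      Tendsto (fun n => ∫ z, f z ∂(Measure.sum (μ n))) atTop
        (nhds (∫ z, f z ∂(Measure.sum ν))) := by
  have hmass (i : ι) : Tendsto (fun n => μ n i Set.univ) atTop (nhds (ν i Set.univ)) := by
    have h := hconv i (fun _ => 1) continuous_const ⟨1, by simp⟩
    simp only [integral_const, smul_eq_mul, mul_one] at h
    exact (ENNReal.tendsto_toReal_iff (fun _ => measure_ne_top _ _) (measure_ne_top _ _)).1 h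
  have hlim {ε : ℝ} {J : Finset ι} (h : ∀ᶠ n in atTop,
      ∑' i : {i // i ∉ J}, μ n i Set.univ ≤ ENNReal.ofReal ε) :
      ∑' i : {i // i ∉ J}, ν i Set.univ ≤ ENNReal.ofReal ε := by
    refine ENNReal.summable.tsum_le_of_sum_le fun s => ?_
    refine le_of_tendsto (tendsto_finsetSum s fun i _ => hmass i) ?_
    filter_upwards [h] with n hn using (ENNReal.sum_le_tsum s).trans hn
  refine ⟨?_, fun f hf ⟨C, hC⟩ => ?_⟩
  · obtain ⟨J, hJ⟩ := htail 1 one_pos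
    rw [← ENNReal.summable.tsum_add_tsum_compl (s := (J : Set ι)) ENNReal.summable,
      Finset.tsum_subtype' J fun i => ν i Set.univ]
    exact ENNReal.add_ne_top.2 ⟨ENNReal.sum_ne_top.2 fun i _ => measure_ne_top _ _,
      ne_top_of_le_ne_top ENNReal.ofReal_ne_top (hlim hJ)⟩
  · have hC' (z : Z) : |f z| ≤ |C| + 1 := by linarith [hC z, le_abs_self C]
    have hC0 : 0 < |C| + 1 := by positivity
    refine Metric.tendsto_nhds.2 fun ε hε => ?_
    set δ : ℝ := ε / (4 * (|C| + 1)) with hδ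
    have hδ0 : 0 < δ := by positivity
    have hδε : (|C| + 1) * δ = ε / 4 := by rw [hδ]; field_simp
    obtain ⟨J, hJ⟩ := htail δ hδ0
    have hsum := tendsto_finsetSum J fun i _ => hconv i f hf ⟨C, hC⟩
    have hfm : StronglyMeasurable f := hf.measurable.stronglyMeasurable
    have hν := abs_integral_sum_sub_finsetSum_le ν J hδ0.le (hlim hJ) hfm hC' hC0.le
    filter_upwards [hJ, Metric.tendsto_nhds.1 hsum (ε / 4) (by positivity)] with n hn hd
    have hμ := abs_integral_sum_sub_finsetSum_le (μ n) J hδ0.le hn hfm hC' hC0.le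
    rw [hδε, abs_le] at hν hμ
    rw [Real.dist_eq, abs_lt] at hd ⊢
    constructor <;> linarith [hν.1, hν.2, hμ.1, hμ.2, hd.1, hd.2]

/-- Small tails at each height and small mass above some height give small tails on the tree. -/
lemma exists_finset_tsum_notMem_le (m : ℕ → UlamTree → ENNReal)
    (hlevel : ∀ (h : ℕ) (ε : ℝ), 0 < ε → ∃ I : Set UlamTree, I.Finite ∧
      I ⊆ {p : UlamTree | p.length = h} ∧ ∃ N : ℕ, ∀ n ≥ N,
        ∑' p : {p : UlamTree // p.length = h ∧ p ∉ I}, m n p ≤ ENNReal.ofReal ε)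
    (hheight : ∀ ε : ℝ, 0 < ε → ∃ h N : ℕ, ∀ n ≥ N,
      ∑' p : {p : UlamTree // h < p.length}, m n p ≤ ENNReal.ofReal ε)
    {ε : ℝ} (hε : 0 < ε) :
    ∃ J : Finset UlamTree, ∀ᶠ n in atTop,
      ∑' p : {p // p ∉ J}, m n p ≤ ENNReal.ofReal ε := by
  obtain ⟨h, N, hN⟩ := hheight (ε / 2) (half_pos hε)
  have hδ : 0 < ε / 2 / (h + 1) := by positivity
  choose I hIfin _ M hM using fun k => hlevel k _ hδ
  refine ⟨(Finset.range (h + 1)).biUnion fun k => (hIfin k).toFinset, ?_⟩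
  filter_upwards [eventually_ge_atTop N,
    (Finset.eventually_all (Finset.range (h + 1))).2 fun k _ => eventually_ge_atTop (M k)]
    with n hn hnM
  have hsub : {p | p ∉ (Finset.range (h + 1)).biUnion fun k => (hIfin k).toFinset} ⊆
      {p : UlamTree | h < p.length} ∪
        ⋃ k ∈ Finset.range (h + 1), {p : UlamTree | p.length = k ∧ p ∉ I k} := by
    intro p hp
    by_cases hl : h < p.length
    · exact Or.inl hl
    · refine Or.inr (Set.mem_biUnion (x := p.length) (by simp; omega) ⟨rfl, fun hpI => hp ?_⟩)
      simp only [Finset.mem_biUnion, Finset.mem_range, Set.Finite.mem_toFinset]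
      exact ⟨p.length, by omega, hpI⟩
  calc _ ≤ _ := ENNReal.tsum_mono_subtype (m n) hsub
    _ ≤ _ := ENNReal.tsum_union_le (m n) _ _
    _ ≤ ENNReal.ofReal (ε / 2) + ∑ k ∈ Finset.range (h + 1), ENNReal.ofReal (ε / 2 / (h + 1)) :=
        add_le_add (hN n hn) ((ENNReal.tsum_biUnion_le (m n) _ _).trans
          (Finset.sum_le_sum fun k hk => hM k n (hnM k hk)))
    _ = ENNReal.ofReal ε := by
        rw [← ENNReal.ofReal_sum_of_nonneg fun _ _ => hδ.le,
          ← ENNReal.ofReal_add (half_pos hε).le (Finset.sum_nonneg fun _ _ => hδ.le)]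
        congr 1
        simp only [Finset.sum_const, Finset.card_range, nsmul_eq_mul]
        push_cast
        field_simp
        ring

/-- Weak convergence of the summed measures of glued decorations.  If for each
`p` in the Ulam tree the finite Borel measures `μⁿ_p` converge weakly to
`μ_p`, if at each height `h` the total mass outside a finite set of indices is
eventually at most any `ε > 0`, and if the total mass above some height is
eventually at most any `ε > 0`, then the limiting total mass `∑_p μ_p(Z)` is
finite and the summed measures `∑_p μⁿ_p` converge weakly to `∑_p μ_p`. -/
theorem sum_measures_tendsto_of_glued_decorations
    {Z : Type*} [MetricSpace Z] [MeasurableSpace Z] [BorelSpace Z]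
    (μ : ℕ → UlamTree → Measure Z) (μlim : UlamTree → Measure Z)
    (hfin : ∀ n p, IsFiniteMeasure (μ n p)) (hfin' : ∀ p, IsFiniteMeasure (μlim p))
    (h1 : ∀ p : UlamTree, ∀ f : Z → ℝ, Continuous f → (∃ C : ℝ, ∀ z, |f z| ≤ C) →
      Tendsto (fun n => ∫ z, f z ∂(μ n p)) atTop (nhds (∫ z, f z ∂(μlim p))))
    (h2 : ∀ (h : ℕ) (ε : ℝ), 0 < ε → ∃ I : Set UlamTree, I.Finite ∧
      I ⊆ {p : UlamTree | p.length = h} ∧ ∃ N : ℕ, ∀ n ≥ N,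
        ∑' p : {p : UlamTree // p.length = h ∧ p ∉ I}, μ n p Set.univ
          ≤ ENNReal.ofReal ε)
    (h3 : ∀ ε : ℝ, 0 < ε → ∃ h N : ℕ, ∀ n ≥ N,
      ∑' p : {p : UlamTree // h < p.length}, μ n p Set.univ ≤ ENNReal.ofReal ε) :
    (∑' p : UlamTree, μlim p Set.univ ≠ ⊤) ∧
    ∀ f : Z → ℝ, Continuous f → (∃ C : ℝ, ∀ z, |f z| ≤ C) →
      Tendsto (fun n => ∫ z, f z ∂(Measure.sum fun p : UlamTree => μ n p)) atTop
        (nhds (∫ z, f z ∂(Measure.sum fun p : UlamTree => μlim p))) := by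
  exact tsum_ne_top_and_tendsto_integral_sum μ μlim h1 fun ε hε =>
    exists_finset_tsum_notMem_le (fun n p => μ n p Set.univ) h2 h3 hε
end

section
/- Let d ≥ 1 and for i, j ∈ {1,…,d} let x^{i,j} : [0,∞) → ℝ be functions with x^{i,j}(0) = 0 such that x^{i,j} is nondecreasing whenever i ≠ j, and such that each diagonal function x^{i,i} is unbounded below (for every M > 0 there exists t with x^{i,i}(t) ≤ −M). Fix r = (r_1,…,r_d) with r_i ≥ 0. Define recursively u^{(0)}_i = inf{t ≥ 0 : x^{i,i}(t) ≤ −r_i} and u^{(h+1)}_i = inf{t ≥ 0 : x^{i,i}(t) ≤ −(r_i + ∑_{ℓ≠i} x^{ℓ,i}(u^{(h)}_ℓ))}. Then all u^{(h)}_i are finite and, for each i, the sequence h ↦ u^{(h)}_i is nondecreasing. -/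
/-- The iterative scheme approximating the multivariate first hitting time of
an additive field: `u⁽⁰⁾ᵢ = inf {t ≥ 0 : xⁱⁱ(t) ≤ -rᵢ}` and
`u⁽ʰ⁺¹⁾ᵢ = inf {t ≥ 0 : xⁱⁱ(t) ≤ -(rᵢ + ∑_{ℓ≠i} x^{ℓ,i}(u⁽ʰ⁾_ℓ))}`. -/
noncomputable def hitIter (d : ℕ) (x : Fin d → Fin d → ℝ → ℝ) (r : Fin d → ℝ) :
    ℕ → Fin d → ℝ
  | 0 => fun i => sInf {t : ℝ | 0 ≤ t ∧ x i i t ≤ -(r i)}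
  | (h + 1) => fun i => sInf {t : ℝ | 0 ≤ t ∧
      x i i t ≤ -(r i + ∑ ℓ ∈ Finset.univ.erase i, x ℓ i (hitIter d x r h ℓ))}

/-- A path on `[0, ∞)` that is unbounded below passes below every level. -/
theorem nonempty_firstPassage_set {f : ℝ → ℝ}
    (hf : ∀ M : ℝ, 0 < M → ∃ t : ℝ, 0 ≤ t ∧ f t ≤ -M) (a : ℝ) :
    {t : ℝ | 0 ≤ t ∧ f t ≤ -a}.Nonempty := by
  obtain ⟨t, ht, hft⟩ := hf (max a 1) (lt_max_of_lt_right one_pos)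
  exact ⟨t, ht, hft.trans (neg_le_neg (le_max_left a 1))⟩

/-- The first passage time below `-a` is nondecreasing in `a`. -/
theorem sInf_firstPassage_mono {f : ℝ → ℝ}
    (hf : ∀ M : ℝ, 0 < M → ∃ t : ℝ, 0 ≤ t ∧ f t ≤ -M) {a b : ℝ} (hab : a ≤ b) :
    sInf {t : ℝ | 0 ≤ t ∧ f t ≤ -a} ≤ sInf {t : ℝ | 0 ≤ t ∧ f t ≤ -b} :=
  csInf_le_csInf ⟨0, fun _ ht => ht.1⟩ (nonempty_firstPassage_set hf b)
    fun _ ht => ⟨ht.1, ht.2.trans (neg_le_neg hab)⟩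

theorem hitIter_nonneg (d : ℕ) (x : Fin d → Fin d → ℝ → ℝ) (r : Fin d → ℝ) (h : ℕ)
    (i : Fin d) : 0 ≤ hitIter d x r h i := by
  cases h <;> exact Real.sInf_nonneg fun _ ht => ht.1

theorem hitIter_le_succ {d : ℕ} {x : Fin d → Fin d → ℝ → ℝ}
    (hx0 : ∀ i j : Fin d, x i j 0 = 0)
    (hmono : ∀ i j : Fin d, i ≠ j → MonotoneOn (x i j) (Set.Ici (0 : ℝ)))
    (hunbdd : ∀ i : Fin d, ∀ M : ℝ, 0 < M → ∃ t : ℝ, 0 ≤ t ∧ x i i t ≤ -M)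
    (r : Fin d → ℝ) (h : ℕ) (i : Fin d) :
    hitIter d x r h i ≤ hitIter d x r (h + 1) i := by
  induction h generalizing i with
  | zero =>
    refine sInf_firstPassage_mono (hunbdd i)
      (le_add_of_nonneg_right (Finset.sum_nonneg fun ℓ hℓ => ?_))
    have hu := hitIter_nonneg d x r 0 ℓ
    simpa only [hx0] using
      hmono ℓ i (Finset.ne_of_mem_erase hℓ) Set.self_mem_Ici hu hu
  | succ h ih =>
    refine sInf_firstPassage_mono (hunbdd i) ?_
    gcongr with ℓ hℓ
    exact hmono ℓ i (Finset.ne_of_mem_erase hℓ) (hitIter_nonneg d x r h ℓ)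
      (hitIter_nonneg d x r (h + 1) ℓ) (ih ℓ)

/-- For an additive field with `x^{i,j}(0) = 0`, nondecreasing off-diagonal
coordinates and diagonal coordinates unbounded below, and any `r ≥ 0`, all the
iterates `u⁽ʰ⁾ᵢ` are finite (the defining sets are nonempty, hence the infima
are over nonempty sets of nonnegative reals) and, for each `i`, the sequence
`h ↦ u⁽ʰ⁾ᵢ` is nondecreasing. -/
theorem hitIter_nonempty_and_monotone
    (d : ℕ) (hd : 1 ≤ d)
    (x : Fin d → Fin d → ℝ → ℝ)
    (hx0 : ∀ i j : Fin d, x i j 0 = 0)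
    (hmono : ∀ i j : Fin d, i ≠ j → MonotoneOn (x i j) (Set.Ici (0 : ℝ)))
    (hunbdd : ∀ i : Fin d, ∀ M : ℝ, 0 < M → ∃ t : ℝ, 0 ≤ t ∧ x i i t ≤ -M)
    (r : Fin d → ℝ) (hr : ∀ i, 0 ≤ r i) :
    (∀ i : Fin d, {t : ℝ | 0 ≤ t ∧ x i i t ≤ -(r i)}.Nonempty) ∧
    (∀ (h : ℕ) (i : Fin d), {t : ℝ | 0 ≤ t ∧
      x i i t ≤ -(r i + ∑ ℓ ∈ Finset.univ.erase i,
        x ℓ i (hitIter d x r h ℓ))}.Nonempty) ∧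
    (∀ i : Fin d, Monotone fun h : ℕ => hitIter d x r h i) := by
  exact ⟨fun i => nonempty_firstPassage_set (hunbdd i) _,
    fun _ i => nonempty_firstPassage_set (hunbdd i) _,
    fun i => monotone_nat_of_le_succ fun h => hitIter_le_succ hx0 hmono hunbdd r h i⟩
end
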